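/- Let n ∈ ℕ, let a₃, α₀, …, αₙ ∈ ℂ and e₀ ∈ ℂ∖{0}. Then the assignment k(x_1) = qx_1, k(x_2) = q²x_2, k(x_3) = q⁻¹x_3, e(x_1) = −qe₀⁻¹x_1x_2 − Σ_{p=0}^{n} (q·(p+1)_q/(p+3)_q)·αₚ x_1^{p+3}x_3^{p}, e(x_2) = −qe₀⁻¹x_2², e(x_3) = a₃x_1 + e₀⁻¹x_2x_3 + Σ_{p=0}^{n} αₚ x_1^{p+2}x_3^{p+1}, f(x_1) = 0, f(x_2) = e₀·1, f(x_3) = 0, extended by the module-algebra conditions, defines a module-algebra structure of U_q(sl(2)) on the quantum 3-space A_q(3). -/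

import Mathlib

noncomputable section

open scoped BigOperators

/-- The defining relations of the quantum `n`-space `A_q(n)`:
`x_i x_j = q • (x_j x_i)` for `i > j`. -/
inductive QRel (q : ℂ) (n : ℕ) : FreeAlgebra ℂ (Fin n) → FreeAlgebra ℂ (Fin n) → Prop
  | rel (i j : Fin n) (h : j < i) :
      QRel q n (FreeAlgebra.ι ℂ i * FreeAlgebra.ι ℂ j)
        (q • (FreeAlgebra.ι ℂ j * FreeAlgebra.ι ℂ i))

/-- The quantum `n`-space `A_q(n)`. -/
abbrev QSpace (q : ℂ) (n : ℕ) : Type := RingQuot (QRel q n)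

/-- The generator `x_i` of the quantum `n`-space. -/
def Xg (q : ℂ) (n : ℕ) (i : Fin n) : QSpace q n :=
  RingQuot.mkAlgHom ℂ (QRel q n) (FreeAlgebra.ι ℂ i)

/-- The Cartan matrix of `sl(m+1)`: `a_{ii} = 2`, `a_{ij} = -1` if `|i-j| = 1`,
`a_{ij} = 0` if `|i-j| > 1`. -/
def cartan (m : ℕ) (i j : Fin m) : ℤ :=
  if i = j then 2 else if ((i : ℤ) - (j : ℤ)).natAbs = 1 then -1 else 0

/-- A module-algebra structure of `U_q(sl(m+1))` on a unital `ℂ`-algebra `A`: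
`ℂ`-linear maps `k_i` (unital algebra automorphisms with two-sided inverses `(k i).symm`),
`e_i`, `f_i` for `1 ≤ i ≤ m`, satisfying the twisted Leibniz rules and the defining
operator relations of `U_q(sl(m+1))`. -/
structure UqslMA (q : ℂ) (m : ℕ) (A : Type) [Ring A] [Algebra ℂ A] where
  k : Fin m → (A ≃ₐ[ℂ] A)
  e : Fin m → (A →ₗ[ℂ] A)
  f : Fin m → (A →ₗ[ℂ] A)
  e_mul : ∀ (i : Fin m) (a b : A), e i (a * b) = a * e i b + e i a * k i b
  f_mul : ∀ (i : Fin m) (a b : A), f i (a * b) = (k i).symm a * f i b + f i a * b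
  e_one : ∀ i : Fin m, e i 1 = 0
  f_one : ∀ i : Fin m, f i 1 = 0
  k_comm : ∀ (i j : Fin m) (a : A), k i (k j a) = k j (k i a)
  ke : ∀ (i j : Fin m) (a : A), k i (e j ((k i).symm a)) = q ^ cartan m i j • e j a
  kf : ∀ (i j : Fin m) (a : A), k i (f j ((k i).symm a)) = q ^ (-cartan m i j) • f j a
  ef : ∀ (i j : Fin m) (a : A),
      e i (f j a) - f j (e i a) =
        if i = j then (q - q⁻¹)⁻¹ • (k i a - (k i).symm a) else 0
  ee_comm : ∀ i j : Fin m, cartan m i j = 0 → ∀ a : A, e i (e j a) = e j (e i a)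
  ff_comm : ∀ i j : Fin m, cartan m i j = 0 → ∀ a : A, f i (f j a) = f j (f i a)
  serre_e : ∀ i j : Fin m, cartan m i j = -1 → ∀ a : A,
      e i (e i (e j a)) - (q + q⁻¹) • e i (e j (e i a)) + e j (e i (e i a)) = 0
  serre_f : ∀ i j : Fin m, cartan m i j = -1 → ∀ a : A,
      f i (f i (f j a)) - (q + q⁻¹) • f i (f j (f i a)) + f j (f i (f i a)) = 0

/-- Isomorphism of module-algebra structures: an algebra automorphism `ψ` of `A` with
`ψ ∘ π₁(h) ∘ ψ⁻¹ = π₂(h)` for every generator `h ∈ {k_i^{±1}, e_i, f_i}`. -/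
def UqslMA.Iso {q : ℂ} {m : ℕ} {A : Type} [Ring A] [Algebra ℂ A]
    (π₁ π₂ : UqslMA q m A) : Prop :=
  ∃ ψ : A ≃ₐ[ℂ] A,
    (∀ (i : Fin m) (a : A), ψ (π₁.k i (ψ.symm a)) = π₂.k i a) ∧
    (∀ (i : Fin m) (a : A), ψ ((π₁.k i).symm (ψ.symm a)) = (π₂.k i).symm a) ∧
    (∀ (i : Fin m) (a : A), ψ (π₁.e i (ψ.symm a)) = π₂.e i a) ∧
    (∀ (i : Fin m) (a : A), ψ (π₁.f i (ψ.symm a)) = π₂.f i a)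

/-- The generator `x_1` of the quantum 3-space. -/
def Z1 (q : ℂ) : QSpace q 3 := Xg q 3 0
/-- The generator `x_2` of the quantum 3-space. -/
def Z2 (q : ℂ) : QSpace q 3 := Xg q 3 1
/-- The generator `x_3` of the quantum 3-space. -/
def Z3 (q : ℂ) : QSpace q 3 := Xg q 3 2

/-- The `q`-integer `(n)_q = (qⁿ − 1)/(q − 1)`. -/
def qInt (q : ℂ) (n : ℕ) : ℂ := (q ^ n - 1) / (q - 1)

theorem QSpace.generator_mul (q : ℂ) (n : ℕ) {i j : Fin n} (h : j < i) :
    Xg q n i * Xg q n j = q • (Xg q n j * Xg q n i) := by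
  have := RingQuot.mkAlgHom_rel ℂ (QRel.rel (q := q) i j h)
  simpa only [map_mul, map_smul, Xg] using this

@[elab_as_elim]
theorem QSpace.induction {q : ℂ} {n : ℕ} {P : QSpace q n → Prop}
    (scalar : ∀ c : ℂ, P (algebraMap ℂ _ c)) (gen : ∀ i, P (Xg q n i))
    (mul : ∀ a b, P a → P b → P (a * b)) (add : ∀ a b, P a → P b → P (a + b))
    (a : QSpace q n) : P a := by
  obtain ⟨b, rfl⟩ := RingQuot.mkAlgHom_surjective ℂ (QRel q n) a
  induction b using FreeAlgebra.induction with
  | grade0 r => rw [AlgHom.commutes]; exact scalar r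
  | grade1 i => exact gen i
  | mul a b ha hb => rw [map_mul]; exact mul _ _ ha hb
  | add a b ha hb => rw [map_add]; exact add _ _ ha hb

/-- The algebra homomorphism out of `A_q(n)` given by images of the generators. -/
def QSpace.lift {q : ℂ} {n : ℕ} {B : Type} [Ring B] [Algebra ℂ B] (v : Fin n → B)
    (hv : ∀ i j, j < i → v i * v j = q • (v j * v i)) : QSpace q n →ₐ[ℂ] B :=
  RingQuot.liftAlgHom ℂ ⟨FreeAlgebra.lift ℂ v, by
    rintro _ _ ⟨i, j, h⟩
    simpa only [map_mul, map_smul, FreeAlgebra.lift_ι_apply] using hv i j h⟩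

theorem QSpace.lift_generator {q : ℂ} {n : ℕ} {B : Type} [Ring B] [Algebra ℂ B] (v : Fin n → B)
    (hv : ∀ i j, j < i → v i * v j = q • (v j * v i)) (i : Fin n) :
    QSpace.lift v hv (Xg q n i) = v i := by
  rw [QSpace.lift, Xg, RingQuot.liftAlgHom_mkAlgHom_apply, FreeAlgebra.lift_ι_apply]

/-- The endomorphism of `A_q(n)` multiplying each generator `x_i` by `c i`. -/
def QSpace.scale (q : ℂ) {n : ℕ} (c : Fin n → ℂ) : QSpace q n →ₐ[ℂ] QSpace q n :=
  QSpace.lift (fun i => c i • Xg q n i) fun i j h => by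
    rw [smul_mul_smul_comm, smul_mul_smul_comm, QSpace.generator_mul q n h, smul_smul, smul_smul]
    congr 1
    ring

theorem QSpace.scale_generator (q : ℂ) {n : ℕ} (c : Fin n → ℂ) (i : Fin n) :
    QSpace.scale q c (Xg q n i) = c i • Xg q n i :=
  QSpace.lift_generator _ _ i

theorem QSpace.scale_scale (q : ℂ) {n : ℕ} (c d : Fin n → ℂ) (h : ∀ i, c i * d i = 1)
    (a : QSpace q n) : QSpace.scale q c (QSpace.scale q d a) = a := by
  induction a using QSpace.induction with
  | scalar r => simp only [AlgHom.commutes]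
  | gen i =>
    rw [QSpace.scale_generator, map_smul, QSpace.scale_generator, smul_smul, mul_comm, h, one_smul]
  | mul a b ha hb => rw [map_mul, map_mul, ha, hb]
  | add a b ha hb => rw [map_add, map_add, ha, hb]

/-- The diagonal automorphism of `A_q(n)` with nonzero weights `c`. -/
def QSpace.scaleEquiv (q : ℂ) {n : ℕ} (c : Fin n → ℂ) (hc : ∀ i, c i ≠ 0) :
    QSpace q n ≃ₐ[ℂ] QSpace q n :=
  AlgEquiv.ofAlgHom (QSpace.scale q c) (QSpace.scale q fun i => (c i)⁻¹)
    (AlgHom.ext fun a => QSpace.scale_scale q _ _ (fun i => mul_inv_cancel₀ (hc i)) a)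
    (AlgHom.ext fun a => QSpace.scale_scale q _ _ (fun i => inv_mul_cancel₀ (hc i)) a)

theorem QSpace.scaleEquiv_generator (q : ℂ) {n : ℕ} (c : Fin n → ℂ) (hc : ∀ i, c i ≠ 0)
    (i : Fin n) : QSpace.scaleEquiv q c hc (Xg q n i) = c i • Xg q n i :=
  QSpace.scale_generator q c i

theorem QSpace.scaleEquiv_symm_generator (q : ℂ) {n : ℕ} (c : Fin n → ℂ) (hc : ∀ i, c i ≠ 0)
    (i : Fin n) : (QSpace.scaleEquiv q c hc).symm (Xg q n i) = (c i)⁻¹ • Xg q n i :=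
  QSpace.scale_generator q _ i

/-- `D` is a skew derivation relative to the maps `σ` and `τ`. -/
def IsSkewDerivation {A : Type} [Ring A] [Algebra ℂ A] (σ τ : A → A) (D : A →ₗ[ℂ] A) : Prop :=
  ∀ a b, D (a * b) = σ a * D b + D a * τ b

theorem IsSkewDerivation.map_one {A : Type} [Ring A] [Algebra ℂ A] {σ τ : A → A}
    {D : A →ₗ[ℂ] A} (hD : IsSkewDerivation σ τ D) (hσ : σ 1 = 1) (hτ : τ 1 = 1) : D 1 = 0 := by
  have h := hD 1 1
  rw [hσ, hτ, mul_one, one_mul, mul_one] at h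
  exact left_eq_add.mp h

theorem IsSkewDerivation.map_pow_eq_zero {A : Type} [Ring A] [Algebra ℂ A] {σ τ : A → A}
    {D : A →ₗ[ℂ] A} (hD : IsSkewDerivation σ τ D) (h1 : D 1 = 0) {x : A} (hx : D x = 0) (m : ℕ) :
    D (x ^ m) = 0 := by
  induction m with
  | zero => rw [pow_zero, h1]
  | succ m ih => rw [pow_succ, hD, hx, ih, mul_zero, zero_mul, add_zero]

theorem QSpace.skewDerivation_ext {q : ℂ} {n : ℕ} {σ τ : QSpace q n → QSpace q n}
    {D D' : QSpace q n →ₗ[ℂ] QSpace q n} (hD : IsSkewDerivation σ τ D)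
    (hD' : IsSkewDerivation σ τ D') (h1 : D 1 = D' 1) (h : ∀ i, D (Xg q n i) = D' (Xg q n i))
    (a : QSpace q n) : D a = D' a := by
  induction a using QSpace.induction with
  | scalar r => rw [Algebra.algebraMap_eq_smul_one, map_smul, map_smul, h1]
  | gen i => exact h i
  | mul a b ha hb => rw [hD, hD', ha, hb]
  | add a b ha hb => rw [map_add, map_add, ha, hb]

theorem QSpace.exists_skewDerivation {q : ℂ} {n : ℕ} (σ τ : QSpace q n →ₐ[ℂ] QSpace q n)
    (v : Fin n → QSpace q n)
    (hv : ∀ i j, j < i → σ (Xg q n i) * v j + v i * τ (Xg q n j) =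
      q • (σ (Xg q n j) * v i + v j * τ (Xg q n i))) :
    ∃ D : QSpace q n →ₗ[ℂ] QSpace q n, IsSkewDerivation σ τ D ∧ ∀ i, D (Xg q n i) = v i := by
  let w : Fin n → Matrix (Fin 2) (Fin 2) (QSpace q n) :=
    fun i => !![σ (Xg q n i), v i; 0, τ (Xg q n i)]
  have hw : ∀ i j, j < i → w i * w j = q • (w j * w i) := by
    intro i j h
    have hσ := congrArg σ (QSpace.generator_mul q n h)
    have hτ := congrArg τ (QSpace.generator_mul q n h)
    rw [map_mul, map_smul, map_mul] at hσ hτ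
    ext r s
    fin_cases r <;> fin_cases s <;> simp [w, Matrix.mul_apply, hσ, hτ, hv i j h]
  let M := QSpace.lift w hw
  have hM : ∀ a, M a 0 0 = σ a ∧ M a 1 0 = 0 ∧ M a 1 1 = τ a := by
    intro a
    induction a using QSpace.induction with
    | scalar r => simp [Matrix.algebraMap_matrix_apply]
    | gen i => simp [M, QSpace.lift_generator, w]
    | mul a b ha hb => simp [Matrix.mul_apply, ha, hb]
    | add a b ha hb => simp [ha, hb]
  refine ⟨⟨⟨fun a => M a 0 1, fun a b => by simp⟩, fun c a => by simp⟩, fun a b => ?_, fun i => ?_⟩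
  · simp [Matrix.mul_apply, hM]
  · simp [M, QSpace.lift_generator, w]

theorem pow_mul_pow_of_mul_eq_smul {A : Type} [Ring A] [Algebra ℂ A] {q : ℂ} {x y : A}
    (h : y * x = q • (x * y)) (m l : ℕ) : y ^ m * x ^ l = q ^ (m * l) • (x ^ l * y ^ m) := by
  have h1 : ∀ l : ℕ, y * x ^ l = q ^ l • (x ^ l * y) := by
    intro l
    induction l with
    | zero => simp
    | succ l ih =>
      rw [pow_succ, ← mul_assoc, ih, smul_mul_assoc, mul_assoc, h, mul_smul_comm, smul_smul,
        mul_assoc, pow_succ]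
  induction m with
  | zero => simp
  | succ m ih =>
    rw [pow_succ', mul_assoc, ih, mul_smul_comm, ← mul_assoc, h1, smul_mul_assoc, smul_smul,
      mul_assoc, ← pow_succ', ← pow_add]
    congr 2
    ring

theorem QSpace.skewDerivation_ext_three {q : ℂ} {σ τ : QSpace q 3 → QSpace q 3}
    {D D' : QSpace q 3 →ₗ[ℂ] QSpace q 3} (hD : IsSkewDerivation σ τ D)
    (hD' : IsSkewDerivation σ τ D') (h1 : D 1 = D' 1) (hx : D (Z1 q) = D' (Z1 q))
    (hy : D (Z2 q) = D' (Z2 q)) (hz : D (Z3 q) = D' (Z3 q)) (a : QSpace q 3) : D a = D' a := by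
  refine QSpace.skewDerivation_ext hD hD' h1 (fun i => ?_) a
  fin_cases i
  exacts [hx, hy, hz]

theorem QSpace.exists_skewDerivation_three {q : ℂ} (σ τ : QSpace q 3 →ₐ[ℂ] QSpace q 3)
    (u v w : QSpace q 3)
    (hvu : σ (Z2 q) * u + v * τ (Z1 q) = q • (σ (Z1 q) * v + u * τ (Z2 q)))
    (hwu : σ (Z3 q) * u + w * τ (Z1 q) = q • (σ (Z1 q) * w + u * τ (Z3 q)))
    (hwv : σ (Z3 q) * v + w * τ (Z2 q) = q • (σ (Z2 q) * w + v * τ (Z3 q))) :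
    ∃ D : QSpace q 3 →ₗ[ℂ] QSpace q 3, IsSkewDerivation σ τ D ∧
      D (Z1 q) = u ∧ D (Z2 q) = v ∧ D (Z3 q) = w := by
  obtain ⟨D, hD, h⟩ := QSpace.exists_skewDerivation σ τ ![u, v, w] (by
    intro i j h
    fin_cases i <;> fin_cases j <;> first | exact absurd h (by decide) | skip
    exacts [hvu, hwu, hwv])
  exact ⟨D, hD, h 0, h 1, h 2⟩

theorem mul_monomial_eq_smul {A : Type} [Ring A] [Algebra ℂ A] {q : ℂ} {x y z : A}
    (hyx : y * x = q • (x * y)) (hzy : z * y = q • (y * z)) (d l : ℕ) :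
    y * (x ^ (l + d) * z ^ l) = q ^ d • (x ^ (l + d) * z ^ l * y) := by
  have h1 := pow_mul_pow_of_mul_eq_smul hyx 1 (l + d)
  have h2 := pow_mul_pow_of_mul_eq_smul hzy l 1
  simp only [pow_one, one_mul, mul_one] at h1 h2
  rw [mul_assoc, h2, ← mul_assoc, h1, smul_mul_assoc, mul_smul_comm, smul_smul, mul_assoc]
  congr 1
  ring

theorem monomial_commutator {A : Type} [Ring A] [Algebra ℂ A] {q : ℂ}
    {x z : A} (hzx : z * x = q • (x * z)) (hq' : ∀ N : ℕ, 0 < N → q ^ N ≠ 1) (p : ℕ) :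
    (q * qInt q (p + 1) / qInt q (p + 3)) • (z * (x ^ (p + 3) * z ^ p)) =
      (q * qInt q (p + 1) / qInt q (p + 3)) • (x ^ (p + 3) * z ^ p * z) +
        q • (x ^ (p + 2) * z ^ (p + 1) * x) - q • (x * (x ^ (p + 2) * z ^ (p + 1))) := by
  have h1 := pow_mul_pow_of_mul_eq_smul hzx 1 (p + 3)
  have h2 := pow_mul_pow_of_mul_eq_smul hzx (p + 1) 1
  simp only [pow_one, one_mul, mul_one] at h1 h2
  rw [← mul_assoc z, h1, smul_mul_assoc, mul_assoc, ← pow_succ', mul_assoc, ← pow_succ,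
    mul_assoc, h2, mul_smul_comm, ← mul_assoc, ← pow_succ, ← mul_assoc, ← pow_succ', smul_smul,
    smul_smul, ← add_smul, ← sub_smul]
  congr 1
  have ha : q - 1 ≠ 0 := sub_ne_zero.mpr (by simpa using hq' 1 one_pos)
  have hb : q ^ (p + 3) - 1 ≠ 0 := sub_ne_zero.mpr (hq' _ (by omega))
  unfold qInt
  field_simp
  ring

theorem Uqsl2_on_Aq3_case89_exists (q : ℂ) (hq : q ≠ 0)
    (hq' : ∀ N : ℕ, 0 < N → q ^ N ≠ 1)
    (n : ℕ) (a₃ : ℂ) (α : ℕ → ℂ) (e₀ : ℂ) (he₀ : e₀ ≠ 0) :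
    ∃ π : UqslMA q 1 (QSpace q 3),
      π.k 0 (Z1 q) = q • Z1 q ∧
      π.k 0 (Z2 q) = (q ^ (2 : ℕ)) • Z2 q ∧
      π.k 0 (Z3 q) = q⁻¹ • Z3 q ∧
      π.e 0 (Z1 q) = (-q * e₀⁻¹) • (Z1 q * Z2 q)
          - ∑ p ∈ Finset.range (n + 1),
              (q * qInt q (p + 1) / qInt q (p + 3) * α p) • (Z1 q ^ (p + 3) * Z3 q ^ p) ∧
      π.e 0 (Z2 q) = (-q * e₀⁻¹) • (Z2 q ^ 2) ∧
      π.e 0 (Z3 q) = a₃ • Z1 q + e₀⁻¹ • (Z2 q * Z3 q)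
          + ∑ p ∈ Finset.range (n + 1), α p • (Z1 q ^ (p + 2) * Z3 q ^ (p + 1)) ∧
      π.f 0 (Z1 q) = 0 ∧ π.f 0 (Z2 q) = e₀ • 1 ∧ π.f 0 (Z3 q) = 0 := by
  have hyx : Z2 q * Z1 q = q • (Z1 q * Z2 q) := QSpace.generator_mul q 3 (by decide)
  have hzx : Z3 q * Z1 q = q • (Z1 q * Z3 q) := QSpace.generator_mul q 3 (by decide)
  have hzy : Z3 q * Z2 q = q • (Z2 q * Z3 q) := QSpace.generator_mul q 3 (by decide)
  have hc : ∀ i, (![q, q ^ 2, q⁻¹] : Fin 3 → ℂ) i ≠ 0 := by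
    intro i
    fin_cases i <;> simp [hq]
  obtain ⟨k, hk⟩ : ∃ k : QSpace q 3 ≃ₐ[ℂ] QSpace q 3, k = QSpace.scaleEquiv q ![q, q ^ 2, q⁻¹] hc := ⟨_, rfl⟩
  have hkx : k (Z1 q) = q • Z1 q := by
    rw [hk]; exact QSpace.scaleEquiv_generator q _ hc 0
  have hky : k (Z2 q) = q ^ 2 • Z2 q := by
    rw [hk]; exact QSpace.scaleEquiv_generator q _ hc 1
  have hkz : k (Z3 q) = q⁻¹ • Z3 q := by
    rw [hk]; exact QSpace.scaleEquiv_generator q _ hc 2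
  have hsx : k.symm (Z1 q) = q⁻¹ • Z1 q := by
    rw [hk]; exact QSpace.scaleEquiv_symm_generator q _ hc 0
  have hsy : k.symm (Z2 q) = (q ^ 2)⁻¹ • Z2 q := by
    rw [hk]; exact QSpace.scaleEquiv_symm_generator q _ hc 1
  have hsz : k.symm (Z3 q) = q • Z3 q := by
    rw [hk]; exact (QSpace.scaleEquiv_symm_generator q _ hc 2).trans (congrArg (· • Z3 q) (inv_inv q))
  clear hk
  have hkM : ∀ d l : ℕ, k (Z1 q ^ (l + d) * Z3 q ^ l) = q ^ d • (Z1 q ^ (l + d) * Z3 q ^ l) := by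
    intro d l
    rw [map_mul, map_pow, map_pow, hkx, hkz, smul_pow, smul_pow, smul_mul_smul_comm]
    congr 1
    rw [pow_add, inv_pow]
    field_simp
  obtain ⟨f, hf, hfx, hfy, hfz⟩ := QSpace.exists_skewDerivation_three
    k.symm.toAlgHom (AlgHom.id ℂ _) 0 (e₀ • (1 : QSpace q 3)) 0
    (by simp [hsx]; match_scalars; field_simp) (by simp)
    (by simp [hsz]; module)
  replace hf : ∀ a b, f (a * b) = k.symm a * f b + f a * b := hf
  have hf1 : f 1 = 0 := IsSkewDerivation.map_one hf (map_one k.symm) rfl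
  have hfM : ∀ l m : ℕ, f (Z1 q ^ l * Z3 q ^ m) = 0 := by
    intro l m
    rw [hf, IsSkewDerivation.map_pow_eq_zero hf hf1 hfx, IsSkewDerivation.map_pow_eq_zero hf hf1 hfz,
      mul_zero, zero_mul, add_zero]
  obtain ⟨S, hS⟩ : ∃ S, S = ∑ p ∈ Finset.range (n + 1),
    (q * qInt q (p + 1) / qInt q (p + 3) * α p) • (Z1 q ^ (p + 3) * Z3 q ^ p) := ⟨_, rfl⟩
  obtain ⟨T, hT⟩ : ∃ T, T = ∑ p ∈ Finset.range (n + 1),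
    α p • (Z1 q ^ (p + 2) * Z3 q ^ (p + 1)) := ⟨_, rfl⟩
  rw [← hS, ← hT]
  have hyS : Z2 q * S = q ^ 3 • (S * Z2 q) := by
    rw [hS, Finset.mul_sum, Finset.sum_mul, Finset.smul_sum]
    refine Finset.sum_congr rfl fun p _ => ?_
    rw [mul_smul_comm, mul_monomial_eq_smul hyx hzy 3 p, smul_mul_assoc, smul_comm]
  have hyT : Z2 q * T = q • (T * Z2 q) := by
    rw [hT, Finset.mul_sum, Finset.sum_mul, Finset.smul_sum]
    refine Finset.sum_congr rfl fun p _ => ?_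
    rw [mul_smul_comm, mul_monomial_eq_smul hyx hzy 1 (p + 1), pow_one, smul_mul_assoc,
      smul_comm]
  have hzS : Z3 q * S = S * Z3 q + q • (T * Z1 q) - q • (Z1 q * T) := by
    rw [hS, hT]
    simp only [Finset.mul_sum, Finset.sum_mul, Finset.smul_sum, ← Finset.sum_add_distrib,
      ← Finset.sum_sub_distrib]
    refine Finset.sum_congr rfl fun p _ => ?_
    have h := congrArg (α p • ·) (monomial_commutator hzx hq' p)
    simp only [smul_sub, smul_add, smul_smul] at h
    simp only [mul_smul_comm, smul_mul_assoc, smul_smul]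
    rw [mul_comm _ (α p), h, mul_comm q (α p)]
  have hkS : k S = q ^ 3 • S := by
    rw [hS, map_sum, Finset.smul_sum]
    refine Finset.sum_congr rfl fun p _ => ?_
    rw [map_smul, hkM 3 p, smul_comm]
  have hkT : k T = q • T := by
    rw [hT, map_sum, Finset.smul_sum]
    refine Finset.sum_congr rfl fun p _ => ?_
    rw [map_smul, hkM 1 (p + 1), pow_one, smul_comm]
  have hfS : f S = 0 := by
    rw [hS, map_sum]
    exact Finset.sum_eq_zero fun p _ => by rw [map_smul, hfM, smul_zero]
  have hfT : f T = 0 := by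
    rw [hT, map_sum]
    exact Finset.sum_eq_zero fun p _ => by rw [map_smul, hfM, smul_zero]
  clear hS hT
  have hyx' : ∀ t, Z2 q * (Z1 q * t) = q • (Z1 q * (Z2 q * t)) := fun t => by
    rw [← mul_assoc, hyx, smul_mul_assoc, mul_assoc]
  have hzx' : ∀ t, Z3 q * (Z1 q * t) = q • (Z1 q * (Z3 q * t)) := fun t => by
    rw [← mul_assoc, hzx, smul_mul_assoc, mul_assoc]
  have hzy' : ∀ t, Z3 q * (Z2 q * t) = q • (Z2 q * (Z3 q * t)) := fun t => by
    rw [← mul_assoc, hzy, smul_mul_assoc, mul_assoc]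
  have hkK : ∀ a, k.toAlgHom a = k a := fun _ => rfl
  obtain ⟨e, he, hex, hey, hez⟩ := QSpace.exists_skewDerivation_three
    (AlgHom.id ℂ _) k.toAlgHom ((-q * e₀⁻¹) • (Z1 q * Z2 q) - S) ((-q * e₀⁻¹) • (Z2 q ^ 2))
    (a₃ • Z1 q + e₀⁻¹ • (Z2 q * Z3 q) + T)
    (by
      simp only [AlgHom.id_apply, hkK, hkx, hky]
      simp only [mul_sub, sub_mul, smul_mul_assoc, mul_smul_comm, smul_add,
        smul_sub, smul_smul, pow_two, mul_assoc, hyx, hyx', hyS]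
      match_scalars <;> field_simp)
    (by
      simp only [AlgHom.id_apply, hkK, hkx, hkz]
      simp only [mul_add, add_mul, mul_sub, sub_mul, smul_mul_assoc, mul_smul_comm, smul_add,
        smul_sub, smul_smul, mul_assoc, hzx, hzy, hyx', hzx', hzS]
      match_scalars <;> field_simp <;> ring)
    (by
      simp only [AlgHom.id_apply, hkK, hky, hkz]
      simp only [mul_add, add_mul, smul_mul_assoc, mul_smul_comm, smul_add,
        smul_smul, pow_two, mul_assoc, hyx, hzy, hzy', hyT]
      match_scalars <;> field_simp <;> ring)
  replace he : ∀ a b, e (a * b) = a * e b + e a * k b := he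
  have he1 : e 1 = 0 := IsSkewDerivation.map_one he rfl (map_one k)
  have hqq : q ^ 2 - 1 ≠ 0 := sub_ne_zero.mpr (hq' 2 two_pos)
  have hke : ∀ a, k (e (k.symm a)) = q ^ (2 : ℤ) • e a := by
    refine QSpace.skewDerivation_ext_three (σ := id) (τ := k)
      (D := k.toLinearMap ∘ₗ e ∘ₗ k.symm.toLinearMap) (D' := q ^ (2 : ℤ) • e) ?_ ?_ ?_ ?_ ?_ ?_
    · intro a b
      simp [he]
    · intro a b
      simp [he]
    · simp [he1]
    · simp [hsx, hex, hkx, hky, hkS, smul_smul, pow_two]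
      match_scalars <;> field_simp
    · simp [hsy, hey, hky, smul_smul, pow_two]
      match_scalars
      field_simp
    · simp [hsz, hez, hkx, hky, hkz, hkT, smul_smul, pow_two]
      match_scalars <;> field_simp
  have hkf : ∀ a, k (f (k.symm a)) = q ^ (-2 : ℤ) • f a := by
    refine QSpace.skewDerivation_ext_three (σ := k.symm) (τ := id)
      (D := k.toLinearMap ∘ₗ f ∘ₗ k.symm.toLinearMap) (D' := q ^ (-2 : ℤ) • f) ?_ ?_ ?_ ?_ ?_ ?_
    · intro a b
      simp [hf]
    · intro a b
      simp [hf]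
    · simp [hf1]
    · simp [hsx, hfx]
    · simp [hsy, hfy, zpow_neg]
    · simp [hsz, hfz]
  have hef : ∀ a, e (f a) - f (e a) = (q - q⁻¹)⁻¹ • (k a - k.symm a) := by
    refine QSpace.skewDerivation_ext_three (σ := k.symm) (τ := k)
      (D := e ∘ₗ f - f ∘ₗ e) (D' := (q - q⁻¹)⁻¹ • (k.toLinearMap - k.symm.toLinearMap)) ?_ ?_ ?_ ?_ ?_ ?_
    · intro a b
      have h1 : e (k.symm a) = q ^ (2 : ℤ) • k.symm (e a) := by
        apply k.injective
        rw [hke, map_smul, k.apply_symm_apply]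
      have h2 : k (f b) = q ^ (-2 : ℤ) • f (k b) := by
        rw [← hkf, k.symm_apply_apply]
      simp only [LinearMap.sub_apply, LinearMap.comp_apply, he, hf, map_add, h1, h2,
        mul_sub, sub_mul, smul_mul_smul_comm, ← zpow_add₀ hq, add_neg_cancel, zpow_zero, one_smul]
      abel
    · intro a b
      simp [mul_sub, sub_mul, smul_sub]
    · simp [he1, hf1]
    · simp [hex, hfx, hfy, hf, hfS, hkx, hsx]
      match_scalars
      field_simp
    · simp [hey, hfy, hf, he1, pow_two, hky, hsy]
      match_scalars
      field_simp
      ring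
    · simp [hez, hfx, hfy, hfz, hf, hfT, hkz, hsz]
      match_scalars
      field_simp
      ring
  have hcartan : ∀ i j : Fin 1, cartan 1 i j = 2 := by decide
  exact ⟨{
    k := fun _ => k
    e := fun _ => e
    f := fun _ => f
    e_mul := fun _ => he
    f_mul := fun _ => hf
    e_one := fun _ => he1
    f_one := fun _ => hf1
    k_comm := fun _ _ _ => rfl
    ke := fun i j a => by rw [hcartan, hke]
    kf := fun i j a => by rw [hcartan, hkf]
    ef := fun i j a => by rw [if_pos (Subsingleton.elim i j), hef]
    ee_comm := fun _ _ _ _ => rfl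
    ff_comm := fun _ _ _ _ => rfl
    serre_e := fun i j h => by simp [hcartan] at h
    serre_f := fun i j h => by simp [hcartan] at h },
    hkx, hky, hkz, hex, hey, hez, hfx, hfy, hfz⟩
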